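/- Let H be a complex Hilbert space and let A and B be bounded linear operators on H which are both normal and which commute, i.e. AB = BA. Then for every complex number w the operator wA + B is normal. -/

import Mathlib

open ContinuousLinearMap

/-- An operator `T` is *normal* if `T*T = TT*`.  If `A` and `B` are commuting normal
operators, then `wA + B` is normal for every complex number `w`. -/
theorem sum_normal_of_commuting_normal (H : Type*) [NormedAddCommGroup H]
    [InnerProductSpace ℂ H] [CompleteSpace H] (A B : H →L[ℂ] H)
    (hA : adjoint A * A = A * adjoint A) (hB : adjoint B * B = B * adjoint B)
    (hAB : A * B = B * A) (w : ℂ) :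
    adjoint (w • A + B) * (w • A + B) = (w • A + B) * adjoint (w • A + B) := by
  have h : adjoint A * B = B * adjoint A := IsStarNormal.commute_star_left ⟨hA⟩ hAB
  have h' : adjoint B * A = A * adjoint B := by
    simpa [← star_eq_adjoint] using congrArg star h
  simp only [map_add, map_smulₛₗ, add_mul, mul_add, smul_mul_assoc, mul_smul_comm, hA, hB, h, h',
    smul_add]
  rw [smul_comm]
  abel
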